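/- Let B, T₁ > 0, let 𝒯_B be the set of trajectories ξ with sup_{t≥0} ‖ξ(t)‖_∞ ≤ B, equipped with the Borel σ-algebra induced by the supremum norm and a finite Borel measure μ, and let I = [0, T₁]. For all STL formulae φ, ψ, the function (ξ, t) ↦ ρ(φ, ξ, t) ρ(ψ, ξ, t) is integrable on 𝒯_B × I with respect to μ ⊗ Lebesgue, and the STL kernel k'(φ, ψ) = ∫_{𝒯_B} ∫_I ρ(φ, ξ, t) ρ(ψ, ξ, t) dt dμ(ξ) satisfies the Cauchy–Schwarz inequality k'(φ, ψ)² ≤ k'(φ, φ) · k'(ψ, ψ). -/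

import Mathlib

open scoped BoundedContinuousFunction

/-- Nonnegative time axis `[0,∞)`. -/
abbrev Time : Type := {t : ℝ // 0 ≤ t}

/-- A trajectory: a bounded continuous function `[0,∞) → ℝⁿ`
(`Fin n → ℝ` carries the sup norm). -/
abbrev Traj (n : ℕ) : Type := BoundedContinuousFunction Time (Fin n → ℝ)

/-- STL formulae: atomic predicates given by continuous functions `f_π : ℝⁿ → ℝ`
(asserting `f_π ≥ 0`), negation, conjunction, and until `U_[a,b]` with `0 ≤ a < b`. -/
inductive STLFormula (n : ℕ) : Type
  | atom : C((Fin n → ℝ), ℝ) → STLFormula n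
  | not : STLFormula n → STLFormula n
  | and : STLFormula n → STLFormula n → STLFormula n
  | until_ (a b : ℝ) (ha : 0 ≤ a) (hab : a < b) :
      STLFormula n → STLFormula n → STLFormula n

/-- Quantitative semantics (robustness) of STL. -/
noncomputable def robust {n : ℕ} (ξ : Traj n) : STLFormula n → Time → ℝ
  | .atom f, t => f (ξ t)
  | .not φ, t => - robust ξ φ t
  | .and φ ψ, t => min (robust ξ φ t) (robust ξ ψ t)
  | .until_ a b ha hab φ ψ, t =>
      sSup ((fun t' : Time =>
          min (robust ξ ψ t')
            (sInf ((fun t'' : Time => robust ξ φ t'') '' Set.Icc t t'))) ''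
        Set.Icc (⟨t.1 + a, add_nonneg t.2 ha⟩ : Time)
          (⟨t.1 + b, add_nonneg t.2 (ha.trans hab.le)⟩ : Time))

open MeasureTheory

/-- The set of trajectories bounded (in sup norm) by `B`, as a subspace of
`C_b([0,∞), ℝⁿ)`. -/
abbrev TrajB (n : ℕ) (B : ℝ) : Type := {ξ : Traj n // ∀ t : Time, ‖ξ t‖ ≤ B}

/-- `TrajB` carries its Borel σ-algebra (for the topology induced by the sup norm). -/
noncomputable instance {n : ℕ} {B : ℝ} : MeasurableSpace (TrajB n B) := borel _

instance {n : ℕ} {B : ℝ} : BorelSpace (TrajB n B) := ⟨rfl⟩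

/-- The time interval `I = [0, T₁]`. -/
abbrev TimeI (T₁ : ℝ) : Type := (Set.Icc (0:ℝ) T₁)

/-- Lebesgue measure on `I = [0, T₁]`, obtained from Lebesgue measure on `ℝ`. -/
noncomputable def lebI (T₁ : ℝ) : Measure (TimeI T₁) :=
  volume.comap Subtype.val

/-- The STL kernel `k'(φ, ψ) = ∫_{𝒯_B} ∫_I ρ(φ, ξ, t) ρ(ψ, ξ, t) dt dμ(ξ)`. -/
noncomputable def kSTL {n : ℕ} {B : ℝ} (μ : Measure (TrajB n B)) (T₁ : ℝ)
    (φ ψ : STLFormula n) : ℝ :=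
  ∫ ξ : TrajB n B,
    (∫ t : TimeI T₁,
      robust ξ.1 φ ⟨t.1, t.2.1⟩ * robust ξ.1 ψ ⟨t.1, t.2.1⟩ ∂(lebI T₁)) ∂μ

theorem image_Icc_reparam (u v : Time) (huv : u ≤ v) (g : Time → ℝ) (p : ℝ → Time)
    (hp : ∀ r, 0 ≤ r → r ≤ 1 → (p r).1 = u.1 + r * (v.1 - u.1)) :
    g '' Set.Icc u v = (fun r : ℝ => g (p r)) '' Set.Icc (0:ℝ) 1 := by
  have huv' : u.1 ≤ v.1 := huv
  ext y
  constructor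
  · rintro ⟨w, ⟨h1, h2⟩, rfl⟩
    have h1' : u.1 ≤ w.1 := h1
    have h2' : w.1 ≤ v.1 := h2
    rcases huv'.eq_or_lt with h | h
    · refine ⟨0, ⟨le_rfl, zero_le_one⟩, ?_⟩
      have : p 0 = w := by
        apply Subtype.ext
        rw [hp 0 le_rfl zero_le_one]; linarith
      simp only [this]
    · have hd : 0 < v.1 - u.1 := by linarith
      have r0 : 0 ≤ (w.1 - u.1) / (v.1 - u.1) := div_nonneg (by linarith) hd.le
      have r1 : (w.1 - u.1) / (v.1 - u.1) ≤ 1 := (div_le_one hd).2 (by linarith)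
      refine ⟨_, ⟨r0, r1⟩, ?_⟩
      have : p ((w.1 - u.1) / (v.1 - u.1)) = w := by
        apply Subtype.ext
        rw [hp _ r0 r1, div_mul_cancel₀ _ hd.ne']; ring
      simp only [this]
  · rintro ⟨r, ⟨r0, r1⟩, rfl⟩
    refine ⟨p r, ⟨?_, ?_⟩, rfl⟩
    · change u.1 ≤ (p r).1
      rw [hp r r0 r1]; nlinarith
    · change (p r).1 ≤ v.1
      rw [hp r r0 r1]; nlinarith

/-- Affine interpolation, truncated to nonnegative times. -/
noncomputable def tpt (x y r : ℝ) : Time := ⟨max 0 (x + r * (y - x)), le_max_left _ _⟩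

theorem tpt_val (u v : Time) (huv : u ≤ v) (r : ℝ) (hr : 0 ≤ r) :
    (tpt u.1 v.1 r).1 = u.1 + r * (v.1 - u.1) := by
  have huv' : u.1 ≤ v.1 := huv
  have := u.2
  have h2 : 0 ≤ r * (v.1 - u.1) := mul_nonneg hr (by linarith)
  exact max_eq_right (by linarith)

theorem robust_continuous {n : ℕ} (φ : STLFormula n) :
    Continuous (fun p : Traj n × Time => robust p.1 φ p.2) := by
  induction φ with
  | atom f =>
    simp only [robust]
    exact f.continuous.comp continuous_eval
  | not φ ih => simp only [robust]; exact ih.neg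
  | and φ ψ ih1 ih2 => simp only [robust]; exact ih1.min ih2
  | until_ a b ha hab φ ψ ih1 ih2 =>
    -- inner infimum
    have hinf : Continuous (fun q : (Traj n × Time) × Time =>
        sInf ((fun r : ℝ => robust q.1.1 φ (tpt q.1.2.1 q.2.1 r)) '' Set.Icc (0:ℝ) 1)) := by
      apply IsCompact.continuous_sInf (f := fun (q : (Traj n × Time) × Time) (r : ℝ) =>
        robust q.1.1 φ (tpt q.1.2.1 q.2.1 r)) isCompact_Icc
      have : Continuous (fun x : ((Traj n × Time) × Time) × ℝ =>
          ((x.1.1.1, tpt x.1.1.2.1 x.1.2.1 x.2) : Traj n × Time)) := by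
        unfold tpt; fun_prop
      exact ih1.comp this
    have hs : Continuous (fun q : Traj n × Time =>
        sSup ((fun s : ℝ => (fun t' : Time => min (robust q.1 ψ t')
          (sInf ((fun r : ℝ => robust q.1 φ (tpt q.2.1 t'.1 r)) '' Set.Icc (0:ℝ) 1)))
            (tpt (q.2.1 + a) (q.2.1 + b) s)) '' Set.Icc (0:ℝ) 1)) := by
      apply IsCompact.continuous_sSup (f := fun (q : Traj n × Time) (s : ℝ) =>
        (fun t' : Time => min (robust q.1 ψ t')
          (sInf ((fun r : ℝ => robust q.1 φ (tpt q.2.1 t'.1 r)) '' Set.Icc (0:ℝ) 1)))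
            (tpt (q.2.1 + a) (q.2.1 + b) s)) isCompact_Icc
      have h1 : Continuous (fun x : (Traj n × Time) × ℝ =>
          ((x.1.1, tpt (x.1.2.1 + a) (x.1.2.1 + b) x.2) : Traj n × Time)) := by
        unfold tpt; fun_prop
      have h2 : Continuous (fun x : (Traj n × Time) × ℝ =>
          ((x.1, tpt (x.1.2.1 + a) (x.1.2.1 + b) x.2) : (Traj n × Time) × Time)) := by
        unfold tpt; fun_prop
      exact (ih2.comp h1).min (hinf.comp h2)
    convert hs using 1
    funext q
    obtain ⟨ξ, t⟩ := q
    simp only [robust]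
    have hle : (⟨t.1 + a, add_nonneg t.2 ha⟩ : Time) ≤
        ⟨t.1 + b, add_nonneg t.2 (ha.trans hab.le)⟩ := by
      change t.1 + a ≤ t.1 + b
      linarith
    rw [← image_Icc_reparam _ _ hle (fun t' : Time => min (robust ξ ψ t')
          (sInf ((fun r : ℝ => robust ξ φ (tpt t.1 t'.1 r)) '' Set.Icc (0:ℝ) 1)))
          (tpt (t.1 + a) (t.1 + b)) (fun r hr _ => tpt_val _ _ hle r hr)]
    congr 1
    apply Set.image_congr
    intro t' ht'
    have htt : t ≤ t' := by
      refine le_trans ?_ ht'.1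
      change t.1 ≤ t.1 + a
      linarith
    rw [image_Icc_reparam t t' htt (fun t'' => robust ξ φ t'') (tpt t.1 t'.1)
      (fun r hr _ => tpt_val _ _ htt r hr)]

theorem robust_bounded {n : ℕ} (B : ℝ) (φ : STLFormula n) :
    ∃ C : ℝ, ∀ (ξ : TrajB n B) (t : Time), |robust ξ.1 φ t| ≤ C := by
  induction φ with
  | atom f =>
    obtain ⟨C, hC⟩ := (isCompact_closedBall (0 : Fin n → ℝ) B).exists_bound_of_continuousOn
      f.continuous.continuousOn
    refine ⟨C, fun ξ t => ?_⟩
    simp only [robust]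
    exact hC _ (by simpa using ξ.2 t)
  | not φ ih =>
    obtain ⟨C, hC⟩ := ih
    exact ⟨C, fun ξ t => by simpa only [robust, abs_neg] using hC ξ t⟩
  | and φ ψ ih1 ih2 =>
    obtain ⟨C, hC⟩ := ih1
    obtain ⟨D, hD⟩ := ih2
    refine ⟨max C D, fun ξ t => ?_⟩
    simp only [robust]
    exact abs_min_le_max_abs_abs.trans (max_le_max (hC ξ t) (hD ξ t))
  | until_ a b ha hab φ ψ ih1 ih2 =>
    obtain ⟨C, hC⟩ := ih1
    obtain ⟨D, hD⟩ := ih2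
    refine ⟨max C D, fun ξ t => ?_⟩
    simp only [robust]
    have key : ∀ (S : Set ℝ) (M : ℝ), S.Nonempty → (∀ x ∈ S, |x| ≤ M) →
        |sSup S| ≤ M ∧ |sInf S| ≤ M := by
      intro S M hS h
      have ha : BddAbove S := ⟨M, fun x hx => (abs_le.1 (h x hx)).2⟩
      have hb : BddBelow S := ⟨-M, fun x hx => (abs_le.1 (h x hx)).1⟩
      obtain ⟨x, hx⟩ := hS
      have h0 := abs_le.1 (h x hx)
      constructor
      · exact abs_le.2 ⟨h0.1.trans (le_csSup ha hx),
          csSup_le ⟨x, hx⟩ fun y hy => (abs_le.1 (h y hy)).2⟩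
      · exact abs_le.2 ⟨le_csInf ⟨x, hx⟩ fun y hy => (abs_le.1 (h y hy)).1,
          (csInf_le hb hx).trans h0.2⟩
    refine (key _ _ ?_ ?_).1
    · refine Set.Nonempty.image _ (Set.nonempty_Icc.2 ?_)
      change t.1 + a ≤ t.1 + b
      linarith
    · rintro _ ⟨t', ht', rfl⟩
      have htt : t ≤ t' := by
        refine le_trans ?_ ht'.1
        change t.1 ≤ t.1 + a
        linarith
      refine abs_min_le_max_abs_abs.trans ?_
      rw [max_comm C D]
      refine max_le_max (hD ξ t') ?_
      refine (key _ _ ((Set.nonempty_Icc.2 htt).image _) ?_).2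
      rintro _ ⟨s, _, rfl⟩
      exact hC ξ s

instance lebI_finite (T₁ : ℝ) : IsFiniteMeasure (lebI T₁) := by
  constructor
  unfold lebI
  rw [(MeasurableEmbedding.subtype_coe measurableSet_Icc).comap_apply, Set.image_univ,
    Subtype.range_coe, Real.volume_Icc]
  exact ENNReal.ofReal_lt_top

theorem integrable_prod_robust {n : ℕ} (B T₁ : ℝ)
    (μ : Measure (TrajB n B)) [IsFiniteMeasure μ] (φ ψ : STLFormula n) :
    Integrable
        (fun p : TrajB n B × TimeI T₁ =>
          robust p.1.1 φ ⟨p.2.1, p.2.2.1⟩ * robust p.1.1 ψ ⟨p.2.1, p.2.2.1⟩)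
        (μ.prod (lebI T₁)) := by
  obtain ⟨C, hC⟩ := robust_bounded B φ
  obtain ⟨D, hD⟩ := robust_bounded B ψ
  have hc : Continuous (fun p : TrajB n B × TimeI T₁ =>
      ((p.1.1, ⟨p.2.1, p.2.2.1⟩) : Traj n × Time)) := by fun_prop
  have h := ((robust_continuous φ).comp hc).mul ((robust_continuous ψ).comp hc)
  refine Integrable.of_bound (C := C * D) h.measurable.aestronglyMeasurable ?_
  refine Filter.Eventually.of_forall fun p => ?_
  rw [Real.norm_eq_abs, abs_mul]
  exact mul_le_mul (hC _ _) (hD _ _) (abs_nonneg _) ((abs_nonneg _).trans (hC p.1 ⟨p.2.1, p.2.2.1⟩))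

/-- for all STL formulae `φ, ψ`, the function
`(ξ, t) ↦ ρ(φ, ξ, t) ρ(ψ, ξ, t)` is integrable on `𝒯_B × I` w.r.t. `μ ⊗ Lebesgue`,
and the STL kernel satisfies the Cauchy–Schwarz inequality
`k'(φ, ψ)² ≤ k'(φ, φ) · k'(ψ, ψ)`. -/
theorem kSTL_cauchy_schwarz {n : ℕ} (B T₁ : ℝ) (hB : 0 < B) (hT : 0 < T₁)
    (μ : Measure (TrajB n B)) [IsFiniteMeasure μ] (φ ψ : STLFormula n) :
    Integrable
        (fun p : TrajB n B × TimeI T₁ =>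
          robust p.1.1 φ ⟨p.2.1, p.2.2.1⟩ * robust p.1.1 ψ ⟨p.2.1, p.2.2.1⟩)
        (μ.prod (lebI T₁)) ∧
      kSTL μ T₁ φ ψ ^ 2 ≤ kSTL μ T₁ φ φ * kSTL μ T₁ ψ ψ := by
  have hi := integrable_prod_robust B T₁ μ
  refine ⟨hi φ ψ, ?_⟩
  have hk : ∀ α β : STLFormula n, kSTL μ T₁ α β = ∫ p : TrajB n B × TimeI T₁,
      robust p.1.1 α ⟨p.2.1, p.2.2.1⟩ * robust p.1.1 β ⟨p.2.1, p.2.2.1⟩ ∂(μ.prod (lebI T₁)) :=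
    fun α β => (integral_prod _ (hi α β)).symm
  have hq : ∀ x : ℝ, 0 ≤ kSTL μ T₁ φ φ * (x * x) + (2 * kSTL μ T₁ φ ψ) * x + kSTL μ T₁ ψ ψ := by
    intro x
    have e : kSTL μ T₁ φ φ * (x * x) + (2 * kSTL μ T₁ φ ψ) * x + kSTL μ T₁ ψ ψ =
        ∫ p : TrajB n B × TimeI T₁, (x * robust p.1.1 φ ⟨p.2.1, p.2.2.1⟩
          + robust p.1.1 ψ ⟨p.2.1, p.2.2.1⟩) ^ 2 ∂(μ.prod (lebI T₁)) := by
      rw [hk, hk, hk, mul_comm _ (x * x), mul_right_comm 2 _ x, ← integral_const_mul,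
        ← integral_const_mul, ← integral_add ((hi φ φ).const_mul _) ((hi φ ψ).const_mul _)]
      refine (integral_add (((hi φ φ).const_mul (x * x)).add ((hi φ ψ).const_mul (2 * x)))
        (hi ψ ψ)).symm.trans ?_
      refine integral_congr_ae (Filter.Eventually.of_forall fun p => ?_)
      simp only [Pi.add_apply]
      ring
    rw [e]
    exact integral_nonneg fun p => sq_nonneg _
  have := discrim_le_zero hq
  unfold discrim at this
  nlinarith
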